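/- Let γ > 0, t > 0, and λ ≥ 0 be real numbers. Then the inverse Laplace (Bromwich) integral representation holds: (1/√t) · cos(√(λt)) = (1/(2π)) ∫_{−∞}^{∞} √(π/(γ + iy)) · exp(−λ/(4(γ + iy)) + (γ + iy)t) dy, where √(π/(γ+iy)) denotes the principal branch of the complex square root (well-defined since Re(γ + iy) = γ > 0), and the (complex-valued) integral converges and is real. -/

import Mathlib

open scoped Real

section

open MeasureTheory Complex Set Filter Topology

/-- The Laplace transform `s ↦ √(π/s) e^{-λ/(4s)}` of `x ↦ cos (√(λx)) / √x`. -/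
noncomputable def cosSqrtLaplace (lam : ℝ) (s : ℂ) : ℂ :=
  ((π : ℂ) / s) ^ (1 / 2 : ℂ) * cexp (-(lam : ℂ) / (4 * s))

/-- The function `x ↦ cos (√(λx)) / √x`, damped by `e^{-γx}` and extended by zero to `x ≤ 0`. -/
noncomputable def dampedCosSqrt (γ lam : ℝ) : ℝ → ℂ :=
  (Ioi (0 : ℝ)).indicator fun x => ((√(lam * x)).cos / √x * Real.exp (-γ * x) : ℝ)

lemma integral_Ioi_cos_mul_cexp_neg_mul_sq {s : ℂ} (hs : 0 < s.re) (c : ℂ) :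
    ∫ u in Ioi (0 : ℝ), 2 * (Complex.cos (c * u) * cexp (-s * u ^ 2)) =
      (π / s) ^ (1 / 2 : ℂ) * cexp (-c ^ 2 / (4 * s)) := by
  have hInt (c : ℂ) : Integrable fun u : ℝ => cexp (I * c * u) * cexp (-s * u ^ 2) := by
    refine (integrable_cexp_quadratic hs (I * c) 0).congr ?_
    refine .of_forall fun u => ?_
    simp only [← Complex.exp_add]
    congr 1
    ring
  rw [← fourierIntegral_gaussian hs c,
    ← intervalIntegral.integral_Iic_add_Ioi (hInt c).integrableOn (hInt c).integrableOn (b := 0)]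
  have h := integral_comp_neg_Ioi 0 fun u : ℝ => cexp (I * c * u) * cexp (-s * u ^ 2)
  rw [neg_zero] at h
  rw [← h, ← integral_add _ (hInt c).integrableOn]
  · congr 1
    ext u
    rw [Complex.cos]
    push_cast
    ring_nf
  · refine ((hInt (-c)).integrableOn).congr (.of_forall fun u => ?_)
    push_cast
    ring_nf

lemma integral_Ioi_cos_sqrt_div_sqrt_mul_cexp {lam : ℝ} (hlam : 0 ≤ lam) {s : ℂ} (hs : 0 < s.re) :
    ∫ x in Ioi (0 : ℝ), (((√(lam * x)).cos / √x : ℝ) : ℂ) * cexp (-s * x) =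
      cosSqrtLaplace lam s := by
  rw [← integral_comp_rpow_Ioi_of_pos two_pos, cosSqrtLaplace]
  have h := integral_Ioi_cos_mul_cexp_neg_mul_sq hs (√lam : ℝ)
  rw [← ofReal_pow, Real.sq_sqrt hlam] at h
  rw [← h]
  refine setIntegral_congr_fun measurableSet_Ioi fun u hu => ?_
  have hu : 0 < u := hu
  have hu' : (u : ℂ) ≠ 0 := by exact_mod_cast hu.ne'
  norm_num [Real.sqrt_mul hlam, Real.sqrt_sq hu.le]
  field_simp

lemma integrable_rpow_mul_exp_indicator {γ a : ℝ} (hγ : 0 < γ) (ha : -1 < a) :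
    Integrable ((Ioi (0 : ℝ)).indicator fun x => x ^ a * Real.exp (-γ * x)) := by
  rw [integrable_indicator_iff measurableSet_Ioi]
  simpa using integrableOn_rpow_mul_exp_neg_mul_rpow ha one_pos hγ

lemma norm_dampedCosSqrt_le (γ lam x : ℝ) :
    ‖dampedCosSqrt γ lam x‖ ≤
      (Ioi (0 : ℝ)).indicator (fun x => x ^ (-(1 / 2) : ℝ) * Real.exp (-γ * x)) x := by
  rw [dampedCosSqrt, norm_indicator_eq_indicator_norm]
  by_cases hx : x ∈ Ioi (0 : ℝ)
  swap
  · simp only [indicator_of_notMem hx, le_refl]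
  simp only [indicator_of_mem hx]
  have hx : 0 < x := hx
  rw [norm_real, Real.norm_eq_abs, abs_mul, Real.abs_exp, abs_div,
    abs_of_nonneg (Real.sqrt_nonneg x), Real.rpow_neg hx.le, ← Real.sqrt_eq_rpow, div_eq_mul_inv]
  gcongr
  exact mul_le_of_le_one_left (by positivity) (Real.abs_cos_le_one _)

lemma measurable_dampedCosSqrt (γ lam : ℝ) : Measurable (dampedCosSqrt γ lam) := by
  refine Measurable.indicator ?_ measurableSet_Ioi
  fun_prop

lemma integrable_dampedCosSqrt {γ : ℝ} (hγ : 0 < γ) (lam : ℝ) :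
    Integrable (dampedCosSqrt γ lam) :=
  (integrable_rpow_mul_exp_indicator hγ (by norm_num)).mono'
    (measurable_dampedCosSqrt γ lam).aestronglyMeasurable
    (.of_forall (norm_dampedCosSqrt_le γ lam))

lemma integrable_smul_dampedCosSqrt {γ : ℝ} (hγ : 0 < γ) (lam : ℝ) :
    Integrable fun x : ℝ => x • dampedCosSqrt γ lam x := by
  refine (integrable_rpow_mul_exp_indicator hγ (a := 1 / 2) (by norm_num)).mono'
    (measurable_id.smul (measurable_dampedCosSqrt γ lam)).aestronglyMeasurable
    (.of_forall fun x => ?_)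
  rw [norm_smul]
  refine (mul_le_mul_of_nonneg_left (norm_dampedCosSqrt_le γ lam x) (norm_nonneg x)).trans_eq ?_
  by_cases hx : x ∈ Ioi (0 : ℝ)
  · have hx' : 0 < x := hx
    simp only [indicator_of_mem hx]
    rw [Real.norm_of_nonneg hx'.le, ← mul_assoc, ← Real.rpow_one_add' hx'.le (by norm_num)]
    norm_num
  · simp only [indicator_of_notMem hx, mul_zero]

lemma fourier_dampedCosSqrt {γ lam : ℝ} (hγ : 0 < γ) (hlam : 0 ≤ lam) (y : ℝ) :
    FourierTransform.fourier (dampedCosSqrt γ lam) ((2 * π)⁻¹ * y) =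
      cosSqrtLaplace lam (γ + y * I) := by
  rw [← integral_Ioi_cos_sqrt_div_sqrt_mul_cexp hlam (by simpa using hγ),
    Real.fourier_real_eq_integral_exp_smul, ← integral_indicator measurableSet_Ioi]
  congr 1
  ext x
  by_cases hx : x ∈ Ioi (0 : ℝ)
  · simp only [dampedCosSqrt, indicator_of_mem hx, smul_eq_mul]
    rw [ofReal_mul _ (Real.exp _), ofReal_exp, mul_left_comm, ← Complex.exp_add]
    congr 2
    push_cast
    field_simp
    ring
  · simp only [dampedCosSqrt, indicator_of_notMem hx, smul_zero]

lemma hasDerivAt_cosSqrtLaplace (lam : ℝ) {s : ℂ} (hs : 0 < s.re) :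
    HasDerivAt (cosSqrtLaplace lam)
      (cosSqrtLaplace lam s * (lam / (4 * s ^ 2) - 1 / (2 * s))) s := by
  have hs0 : s ≠ 0 := by rintro rfl; simp at hs
  have hpi : (π : ℂ) ≠ 0 := by exact_mod_cast Real.pi_ne_zero
  have hslit : (π : ℂ) / s ∈ slitPlane := by
    left
    rw [div_eq_mul_inv, re_ofReal_mul, inv_re]
    have := normSq_pos.2 hs0
    have := Real.pi_pos
    positivity
  have h1 : HasDerivAt (fun s : ℂ => (π : ℂ) / s) (-π / s ^ 2) s := by
    simpa [div_eq_mul_inv] using (hasDerivAt_inv hs0).const_mul (π : ℂ)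
  have h2 : HasDerivAt (fun s : ℂ => -(lam : ℂ) / (4 * s)) (lam / (4 * s ^ 2)) s := by
    convert! (hasDerivAt_inv hs0).const_mul (-(lam : ℂ) / 4) using 1
    · ext z
      rw [div_mul_eq_div_div, div_eq_mul_inv _ z]
    · field_simp
  convert! (h1.cpow_const (c := 1 / 2) hslit).mul h2.cexp using 1
  rw [cosSqrtLaplace, cpow_sub _ _ (div_ne_zero hpi hs0), cpow_one]
  field_simp
  ring

lemma norm_cosSqrtLaplace_le {lam : ℝ} (hlam : 0 ≤ lam) {s : ℂ} (hs : 0 < s.re) :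
    ‖cosSqrtLaplace lam s‖ ≤ (π / ‖s‖) ^ (1 / 2 : ℝ) := by
  have hs0 : s ≠ 0 := by rintro rfl; simp at hs
  rw [cosSqrtLaplace, norm_mul, show (1 / 2 : ℂ) = ((1 / 2 : ℝ) : ℂ) by norm_num, norm_cpow_real,
    norm_div, norm_real, Real.norm_of_nonneg Real.pi_pos.le]
  refine mul_le_of_le_one_right (by positivity) ?_
  rw [norm_exp, Real.exp_le_one_iff]
  have : -(lam : ℂ) / (4 * s) = ((-lam / 4 : ℝ) : ℂ) * s⁻¹ := by
    push_cast
    field_simp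
  rw [this, re_ofReal_mul, inv_re]
  have := normSq_pos.2 hs0
  exact mul_nonpos_of_nonpos_of_nonneg (by linarith) (by positivity)

/-- On the line `Re s = γ`, minus the derivative of `cosSqrtLaplace` is the Fourier transform of
`x ↦ x cos (√(λx)) / √x e^{-γx}`. -/
lemma fourier_smul_dampedCosSqrt {γ lam : ℝ} (hγ : 0 < γ) (hlam : 0 ≤ lam) (y : ℝ) :
    FourierTransform.fourier (fun x : ℝ => x • dampedCosSqrt γ lam x) ((2 * π)⁻¹ * y) =
      -deriv (cosSqrtLaplace lam) (γ + y * I) := by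
  have hline : HasDerivAt (fun y : ℝ => (γ : ℂ) + y * I) I y := by
    simpa using ((hasDerivAt_id y).ofReal_comp.mul_const I).const_add (γ : ℂ)
  have hd := (hasDerivAt_cosSqrtLaplace lam (s := γ + y * I) (by simpa using hγ))
  have h1 := hd.comp y hline
  have h2 := (Real.hasDerivAt_fourier (integrable_dampedCosSqrt hγ lam)
    (integrable_smul_dampedCosSqrt hγ lam) ((2 * π)⁻¹ * y)).scomp y
      ((hasDerivAt_id y).const_mul (2 * π)⁻¹)
  have heq : cosSqrtLaplace lam ∘ (fun y : ℝ => (γ : ℂ) + y * I) =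
      FourierTransform.fourier (dampedCosSqrt γ lam) ∘ fun y : ℝ => (2 * π)⁻¹ * y := by
    ext y
    exact (fourier_dampedCosSqrt hγ hlam y).symm
  rw [heq] at h1
  have h3 := h1.unique h2
  rw [Real.fourier_real_eq] at h3 ⊢
  have h4 : ∫ v : ℝ, Real.fourierChar (-(v * ((2 * π)⁻¹ * y))) •
      ((-2 * π * I * v) • dampedCosSqrt γ lam v) = (-2 * π * I) *
      ∫ v : ℝ, Real.fourierChar (-(v * ((2 * π)⁻¹ * y))) • (v • dampedCosSqrt γ lam v) := by
    rw [← integral_const_mul]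
    congr 1
    ext v
    simp only [Circle.smul_def, smul_eq_mul, real_smul]
    ring
  rw [hd.deriv]
  rw [h4, real_smul] at h3
  have hpi : (π : ℂ) ≠ 0 := by exact_mod_cast Real.pi_ne_zero
  have h5 := congrArg (fun z => z * I) h3
  beta_reduce at h5
  push_cast at h5
  rw [mul_assoc, I_mul_I] at h5
  have h6 : ∀ J : ℂ, ((2 * (π : ℂ))⁻¹ * 1) * (-2 * π * I * J) * I = J := by
    intro J
    field_simp
    rw [I_sq]
    ring
  rw [h6] at h5
  rw [← h5]
  ring

lemma continuous_deriv_cosSqrtLaplace_line {γ : ℝ} (hγ : 0 < γ) (lam : ℝ) :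
    Continuous fun y : ℝ => deriv (cosSqrtLaplace lam) (γ + y * I) := by
  have hd (y : ℝ) := (hasDerivAt_cosSqrtLaplace lam (s := γ + y * I) (by simpa using hγ))
  have h0 (y : ℝ) : (γ : ℂ) + y * I ≠ 0 := fun h => hγ.ne' (by simpa using congrArg re h)
  simp_rw [fun y => (hd y).deriv]
  have hc : Continuous fun y : ℝ => cosSqrtLaplace lam (γ + y * I) :=
    continuous_iff_continuousAt.2 fun y =>
      (hd y).continuousAt.comp (f := fun y : ℝ => (γ : ℂ) + y * I) (by fun_prop)
  refine hc.mul (Continuous.sub ?_ ?_) <;>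
  · refine continuous_const.div (by fun_prop) fun y => ?_
    simp [h0]

lemma integrable_deriv_cosSqrtLaplace_line {γ lam : ℝ} (hγ : 0 < γ) (hlam : 0 ≤ lam) :
    Integrable fun y : ℝ => deriv (cosSqrtLaplace lam) (γ + y * I) := by
  have hb : Integrable fun y : ℝ => (1 + ‖y‖ ^ 2) ^ (-(3 / 2 : ℝ) / 2) :=
    integrable_rpow_neg_one_add_norm_sq (by norm_num)
  obtain ⟨m, hm0, hm⟩ : ∃ m : ℝ, 0 < m ∧ ∀ y : ℝ, m * √(1 + ‖y‖ ^ 2) ≤ ‖(γ : ℂ) + y * I‖ := by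
    refine ⟨min 1 γ, by positivity, fun y => ?_⟩
    rw [norm_add_mul_I, ← Real.sqrt_sq (show 0 ≤ min 1 γ by positivity),
      ← Real.sqrt_mul (sq_nonneg _)]
    refine Real.sqrt_le_sqrt ?_
    rw [Real.norm_eq_abs, sq_abs, mul_add, mul_one]
    have h1 : (min 1 γ) ^ 2 ≤ 1 := pow_le_one₀ (by positivity) (min_le_left _ _)
    have h2 : (min 1 γ) ^ 2 ≤ γ ^ 2 := by gcongr; exact min_le_right _ _
    nlinarith [sq_nonneg y]
  refine (hb.const_mul ((π / m) ^ (1 / 2 : ℝ) * ((lam / (4 * γ) + 1 / 2) * m⁻¹))).mono'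
    (continuous_deriv_cosSqrtLaplace_line hγ lam).aestronglyMeasurable (.of_forall fun y => ?_)
  have hs : 0 < ((γ : ℂ) + y * I).re := by simpa using hγ
  rw [(hasDerivAt_cosSqrtLaplace lam hs).deriv, norm_mul]
  have hge : γ ≤ ‖(γ : ℂ) + y * I‖ := by simpa using re_le_norm ((γ : ℂ) + y * I)
  set s := (γ : ℂ) + y * I
  set q := √(1 + ‖y‖ ^ 2) with hq
  have hq0 : 0 < q := by positivity
  have hqpow : (1 + ‖y‖ ^ 2) ^ (-(3 / 2 : ℝ) / 2) = q⁻¹ ^ (1 / 2 : ℝ) * q⁻¹ := by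
    rw [Real.inv_rpow hq0.le, ← mul_inv, ← Real.rpow_add_one hq0.ne', hq, Real.sqrt_eq_rpow,
      ← Real.rpow_mul (by positivity), ← Real.rpow_neg (by positivity)]
    norm_num
  have hs0 : 0 < ‖s‖ := hγ.trans_le hge
  have hA : ‖cosSqrtLaplace lam s‖ ≤ (π / m) ^ (1 / 2 : ℝ) * q⁻¹ ^ (1 / 2 : ℝ) := by
    refine (norm_cosSqrtLaplace_le hlam hs).trans ?_
    rw [← Real.mul_rpow (by positivity) (by positivity), ← div_eq_mul_inv, div_div]
    have := hm y
    gcongr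
  have hB : ‖(lam : ℂ) / (4 * s ^ 2) - 1 / (2 * s)‖ ≤ (lam / (4 * γ) + 1 / 2) * m⁻¹ * q⁻¹ := by
    calc _ ≤ lam / (4 * ‖s‖ ^ 2) + 1 / (2 * ‖s‖) := by
            refine (norm_sub_le _ _).trans_eq ?_
            simp [abs_of_nonneg hlam]
      _ = (lam / (4 * ‖s‖) + 1 / 2) * ‖s‖⁻¹ := by field_simp
      _ ≤ (lam / (4 * γ) + 1 / 2) * (m * q)⁻¹ := by
            have := hm y
            gcongr
      _ = _ := by rw [mul_inv, mul_assoc]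
  calc _ ≤ _ := mul_le_mul hA hB (norm_nonneg _) (by positivity)
    _ = _ := by rw [hqpow]; ring

lemma integral_deriv_cosSqrtLaplace_mul_cexp {γ t lam : ℝ} (hγ : 0 < γ) (ht : 0 < t)
    (hlam : 0 ≤ lam) :
    ∫ y : ℝ, -deriv (cosSqrtLaplace lam) (γ + y * I) * cexp ((γ + y * I) * t) =
      2 * π * t * ((√(lam * t)).cos / √t : ℝ) := by
  set g : ℝ → ℂ := fun x => x • dampedCosSqrt γ lam x with hg
  have hF : ∀ y : ℝ, FourierTransform.fourier g ((2 * π)⁻¹ * y) =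
      -deriv (cosSqrtLaplace lam) (γ + y * I) := fourier_smul_dampedCosSqrt hγ hlam
  have hInt : Integrable (FourierTransform.fourier g) := by
    rw [← integrable_comp_mul_left_iff (FourierTransform.fourier g)
      (show (2 * π)⁻¹ ≠ 0 by positivity)]
    simp_rw [hF]
    exact (integrable_deriv_cosSqrtLaplace_line hγ hlam).neg
  have hgt : g =ᶠ[𝓝 t] fun x => x • (((√(lam * x)).cos / √x * Real.exp (-γ * x) : ℝ) : ℂ) := by
    filter_upwards [Ioi_mem_nhds ht] with x hx
    simp only [hg, dampedCosSqrt, indicator_of_mem hx]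
  have hcont : ContinuousAt g t := by
    refine ContinuousAt.congr ?_ hgt.symm
    have : √t ≠ 0 := by positivity
    fun_prop (disch := assumption)
  have hinv := Integrable.fourierInv_fourier_eq (f := g)
    (integrable_smul_dampedCosSqrt hγ lam) hInt hcont
  rw [Real.fourierInv_eq', hgt.eq_of_nhds] at hinv
  have hsub := Measure.integral_comp_mul_left
    (fun v : ℝ => cexp (↑(2 * π * inner ℝ v t) * I) • FourierTransform.fourier g v) (2 * π)⁻¹
  rw [hinv] at hsub
  have hpi : (π : ℂ) ≠ 0 := by exact_mod_cast Real.pi_ne_zero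
  calc _ = ∫ y : ℝ, cexp (γ * t) * (cexp (↑(2 * π * inner ℝ ((2 * π)⁻¹ * y) t) * I) •
        FourierTransform.fourier g ((2 * π)⁻¹ * y)) := by
        congr 1
        ext y
        rw [hF, smul_eq_mul, ← mul_assoc, ← Complex.exp_add, mul_comm]
        congr 2
        simp only [RCLike.inner_apply, conj_trivial]
        push_cast
        field_simp
    _ = _ := by
        rw [integral_const_mul, hsub, inv_inv, abs_of_pos Real.two_pi_pos]
        simp only [real_smul]
        push_cast
        have : cexp (γ * t) * cexp (-γ * t) = 1 := by rw [← Complex.exp_add]; simp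
        linear_combination (2 * π * t * (Complex.cos √(lam * t) / √t)) * this

lemma tendsto_cosSqrtLaplace_mul_cexp {γ t lam : ℝ} (hγ : 0 < γ) (hlam : 0 ≤ lam) :
    Tendsto (fun y : ℝ => cosSqrtLaplace lam (γ + y * I) * (cexp ((γ + y * I) * t) / (I * t)))
      (cocompact ℝ) (𝓝 0) := by
  have hs (y : ℝ) : 0 < ((γ : ℂ) + y * I).re := by simpa using hγ
  have hnorm : Tendsto (fun y : ℝ => ‖(γ : ℂ) + y * I‖) (cocompact ℝ) atTop := by
    refine tendsto_atTop_mono (fun y => ?_) (tendsto_norm_cocompact_atTop (E := ℝ))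
    simpa using abs_im_le_norm ((γ : ℂ) + y * I)
  have hF : Tendsto (fun y : ℝ => cosSqrtLaplace lam (γ + y * I)) (cocompact ℝ) (𝓝 0) := by
    refine squeeze_zero_norm (fun y => norm_cosSqrtLaplace_le hlam (hs y)) ?_
    have := (hnorm.const_div_atTop π).rpow_const (p := 1 / 2) (Or.inr (by norm_num))
    simpa using this
  refine hF.zero_mul_isBoundedUnder_le (isBoundedUnder_of ⟨Real.exp (γ * t) / |t|, fun y => ?_⟩)
  simp [norm_exp]

lemma tendsto_intervalIntegral_cosSqrtLaplace_mul_cexp {γ t lam : ℝ} (hγ : 0 < γ) (ht : 0 < t)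
    (hlam : 0 ≤ lam) :
    Tendsto (fun R : ℝ => ∫ y in (-R)..R,
        cosSqrtLaplace lam (γ + y * I) * cexp ((γ + y * I) * t))
      atTop (𝓝 (2 * π * ((√(lam * t)).cos / √t : ℝ))) := by
  have ht0 : (t : ℂ) ≠ 0 := by exact_mod_cast ht.ne'
  have hline (y : ℝ) : HasDerivAt (fun y : ℝ => (γ : ℂ) + y * I) I y := by
    simpa using ((hasDerivAt_id y).ofReal_comp.mul_const I).const_add (γ : ℂ)
  have hu (y : ℝ) : HasDerivAt (fun y : ℝ => cosSqrtLaplace lam (γ + y * I))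
      (deriv (cosSqrtLaplace lam) (γ + y * I) * I) y :=
    HasDerivAt.comp (h₂ := cosSqrtLaplace lam) y (hasDerivAt_cosSqrtLaplace lam (s := γ + y * I)
      (by simpa using hγ)).differentiableAt.hasDerivAt (hline y)
  have hv (y : ℝ) : HasDerivAt (fun y : ℝ => cexp ((γ + y * I) * t) / (I * t))
      (cexp ((γ + y * I) * t)) y := by
    convert! ((hline y).mul_const (t : ℂ)).cexp.div_const (I * t) using 1
    field_simp
  have hparts (R : ℝ) := intervalIntegral.integral_mul_deriv_eq_deriv_mul (a := -R) (b := R)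
    (fun y _ => hu y) (fun y _ => hv y)
    (((continuous_deriv_cosSqrtLaplace_line hγ lam).mul continuous_const).intervalIntegrable _ _)
    ((by fun_prop : Continuous fun y : ℝ => cexp ((γ + y * I) * t)).intervalIntegrable _ _)
  simp_rw [hparts]
  have hbd := tendsto_cosSqrtLaplace_mul_cexp (t := t) hγ hlam
  rw [cocompact_eq_atBot_atTop, tendsto_sup] at hbd
  have hInt : Integrable fun y : ℝ =>
      deriv (cosSqrtLaplace lam) (γ + y * I) * I * (cexp ((γ + y * I) * t) / (I * t)) := by
    refine ((integrable_deriv_cosSqrtLaplace_line hγ hlam).mul_const I).mul_bdd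
      (c := Real.exp (γ * t) / |t|) (by fun_prop) (.of_forall fun y => ?_)
    simp [norm_exp]
  have hlim := ((hbd.2.sub (hbd.1.comp tendsto_neg_atTop_atBot)).sub
    (intervalIntegral_tendsto_integral hInt tendsto_neg_atTop_atBot tendsto_id))
  convert! hlim using 2
  have h := integral_deriv_cosSqrtLaplace_mul_cexp hγ ht hlam
  have heq (y : ℝ) : deriv (cosSqrtLaplace lam) (γ + y * I) * I *
      (cexp ((γ + y * I) * t) / (I * t)) =
      -(t : ℂ)⁻¹ * (-deriv (cosSqrtLaplace lam) (γ + y * I) * cexp ((γ + y * I) * t)) := by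
    field_simp
  simp_rw [heq]
  rw [integral_const_mul, h]
  field_simp
  ring

end

/-- Bromwich (inverse Laplace) integral representation of `(1/√t) cos (√(λt))`:
the contour integral over the vertical line `Re z = γ` converges (as a
symmetric improper integral) to the real value `(1/√t) cos (√(λt))`. -/
theorem bromwich_cos_sqrt (γ t lam : ℝ) (hγ : 0 < γ) (ht : 0 < t) (hlam : 0 ≤ lam) :
    Filter.Tendsto
      (fun R : ℝ => (1 / (2 * (π : ℂ))) *
        ∫ y in (-R)..R,
          ((π : ℂ) / ((γ : ℂ) + (y : ℂ) * Complex.I)) ^ ((1 / 2 : ℂ)) *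
            Complex.exp (-(lam : ℂ) / (4 * ((γ : ℂ) + (y : ℂ) * Complex.I)) +
              ((γ : ℂ) + (y : ℂ) * Complex.I) * (t : ℂ)))
      Filter.atTop
      (nhds (((1 / Real.sqrt t) * Real.cos (Real.sqrt (lam * t)) : ℝ) : ℂ)) := by
  have h := (tendsto_intervalIntegral_cosSqrtLaplace_mul_cexp hγ ht hlam).const_mul
    (1 / (2 * (π : ℂ)))
  simp_rw [cosSqrtLaplace, mul_assoc, ← Complex.exp_add] at h
  convert! h using 2
  have hpi : (π : ℂ) ≠ 0 := by exact_mod_cast Real.pi_ne_zero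
  push_cast
  field_simp
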